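/- Let N, d, k be positive integers with k ≤ N. Let σ be a density operator on (ℂ^d)^{⊗N} (a matrix indexed by functions Fin N → Fin d) such that every vector in the range of σ is symmetric, and let ρ = tr_{k+1,…,N}(σ) be its partial trace over the last N − k tensor factors (so every vector in the range of ρ is symmetric as a k-fold tensor). Then there exists a density operator σ′ on (ℂ^d)^{⊗N}, with every vector in its range symmetric, such that tr_{k+1,…,N}(σ′) = ρ and rank σ′ ≤ rank ρ; moreover rank ρ ≤ C(d + k − 1, k). -/

import Mathlib

open Matrix ComplexOrder

/-- Identify `Fin N → Fin d` with `(Fin k → Fin d) × (Fin (N-k) → Fin d)`: combine an index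
on the first `k` tensor factors with an index on the last `N - k` factors. -/
def appendIdx {N k d : ℕ} (x : Fin k → Fin d) (c : Fin (N - k) → Fin d) : Fin N → Fin d :=
  fun a => if h : (a : ℕ) < k then x ⟨a, h⟩
    else c ⟨(a : ℕ) - k, by have := a.isLt; omega⟩

/-- Partial trace over the last `N - k` tensor factors of a matrix on `(ℂ^d)^{⊗N}`:
`(tr_{k+1,…,N} M)(x, y) = Σ_c M((x,c),(y,c))`. -/
noncomputable def ptrLast (N k d : ℕ) (M : Matrix (Fin N → Fin d) (Fin N → Fin d) ℂ) :
    Matrix (Fin k → Fin d) (Fin k → Fin d) ℂ :=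
  fun x y => ∑ c : Fin (N - k) → Fin d, M (appendIdx x c) (appendIdx y c)

/-- A vector `v : (Fin N → Fin d) → ℂ` is symmetric if `v (f ∘ π) = v f` for every
permutation `π` of `Fin N`. -/
def IsSymVec (N d : ℕ) (v : (Fin N → Fin d) → ℂ) : Prop :=
  ∀ (π : Equiv.Perm (Fin N)) (f : Fin N → Fin d), v (f ∘ π) = v f

/-- A positive semidefinite complex matrix factors through a space of dimension its rank. -/
theorem Matrix.PosSemidef.exists_eq_mul_conjTranspose_rank {n : Type*} [Fintype n]
    {A : Matrix n n ℂ} (hA : A.PosSemidef) :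
    ∃ E : Matrix n (Fin A.rank) ℂ, A = E * Eᴴ := by
  classical
  let l := hA.1.eigenvalues
  let U : Matrix n n ℂ := hA.1.eigenvectorUnitary
  have hcard : Fintype.card {i // l i ≠ 0} = A.rank := hA.1.rank_eq_card_non_zero_eigs.symm
  let e : Fin A.rank ≃ {i // l i ≠ 0} := (Fintype.equivFinOfCardEq hcard).symm
  refine ⟨of fun i j => U i (e j) * (Real.sqrt (l (e j)) : ℂ), ?_⟩
  ext i j
  have hsq (x : n) : (Real.sqrt (l x) : ℂ) * (Real.sqrt (l x) : ℂ) = l x := by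
    rw [← Complex.ofReal_mul, Real.mul_self_sqrt (hA.eigenvalues_nonneg x)]
  have hsupp (x : n) (hx : ¬ l x ≠ 0) : U i x * l x * star (U j x) = 0 := by
    simp [not_not.mp hx]
  have hspec : A i j = ∑ x, U i x * l x * star (U j x) := by
    conv_lhs => rw [hA.1.spectral_theorem, Unitary.conjStarAlgAut_apply]
    simp [Matrix.mul_apply, Matrix.diagonal_apply, U, l]
  have hsub : ∑ x, U i x * l x * star (U j x)
      = ∑ x : {x // l x ≠ 0}, U i x * l x * star (U j x) := by
    rw [← Finset.sum_subtype (Finset.univ.filter fun x => l x ≠ 0) (by simp)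
      fun x => U i x * l x * star (U j x), Finset.sum_filter_of_ne]
    · intro x _ hx h0
      exact hx (hsupp x (not_not.mpr h0))
  rw [hspec, hsub, ← e.sum_comp, Matrix.mul_apply]
  refine Finset.sum_congr rfl fun x _ => ?_
  simp only [conjTranspose_apply, of_apply, star_mul', ← hsq]
  simp
  ring

/-- Moving from the identity along a nonzero Hermitian direction, one meets a singular positive
semidefinite matrix. -/
theorem Matrix.IsHermitian.exists_one_add_smul_posSemidef {n : Type*} [Fintype n] [DecidableEq n]
    {H : Matrix n n ℂ} (hH : H.IsHermitian) (h0 : H ≠ 0) :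
    ∃ t : ℂ, (1 + t • H).PosSemidef ∧ (1 + t • H).rank < Fintype.card n := by
  let l := hH.eigenvalues
  let U : Matrix n n ℂ := hH.eigenvectorUnitary
  obtain ⟨j, hj⟩ : ∃ j, l j ≠ 0 := Function.ne_iff.mp (mt hH.eigenvalues_eq_zero_iff.mp h0)
  obtain ⟨i, -, hi⟩ := Finset.exists_max_image Finset.univ (fun x => |l x|) ⟨j, Finset.mem_univ j⟩
  have hli : l i ≠ 0 := abs_pos.mp ((abs_pos.mpr hj).trans_le (hi j (Finset.mem_univ j)))
  have hUU : U * Uᴴ = 1 := Unitary.mul_star_self_of_mem hH.eigenvectorUnitary.2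
  have hspec : H = U * diagonal (fun x => (l x : ℂ)) * Uᴴ := by
    conv_lhs => rw [hH.spectral_theorem, Unitary.conjStarAlgAut_apply]
    rfl
  have key : 1 + (-(l i : ℂ)⁻¹) • H
      = U * diagonal (fun x => ((1 - l x / l i : ℝ) : ℂ)) * Uᴴ := by
    have hd : diagonal (fun x => ((1 - l x / l i : ℝ) : ℂ))
        = 1 + (-(l i : ℂ)⁻¹) • diagonal (fun x => (l x : ℂ)) := by
      rw [← diagonal_one, ← diagonal_smul, diagonal_add]
      congr 1
      ext x
      simp
      ring
    rw [hd, Matrix.mul_add, Matrix.add_mul, Matrix.mul_one, hUU, Matrix.mul_smul, Matrix.smul_mul,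
      ← hspec]
  refine ⟨-(l i : ℂ)⁻¹, ?_, ?_⟩
  · rw [key]
    refine PosSemidef.mul_mul_conjTranspose_same (PosSemidef.diagonal fun x => ?_) U
    have hx : l x / l i ≤ 1 := by
      refine (le_abs_self _).trans ?_
      rw [abs_div]
      exact div_le_one_of_le₀ (hi x (Finset.mem_univ x)) (abs_nonneg _)
    exact Complex.zero_le_real.mpr (sub_nonneg.mpr hx)
  · rw [key]
    refine ((rank_mul_le_left _ _).trans (rank_mul_le_right _ _)).trans_lt ?_
    rw [rank_diagonal]
    exact Fintype.card_subtype_lt (x := i) (by simp [hli])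

/-- If the kernel of `Cᴴ` is contained in that of `Dᴴ`, then `D` factors through `C`. -/
theorem Matrix.exists_eq_mul_of_conjTranspose_ker_le {m s r : Type*} [Fintype m] [Fintype s]
    [Fintype r] (C : Matrix m s ℂ) (D : Matrix m r ℂ)
    (h : ∀ v, Cᴴ *ᵥ v = 0 → Dᴴ *ᵥ v = 0) : ∃ X : Matrix s r ℂ, D = C * X := by
  classical
  let f := toLin' Cᴴ
  let g := toLin' Dᴴ
  obtain ⟨p, hp⟩ := f.rangeRestrict.exists_rightInverse_of_surjective f.range_rangeRestrict
  obtain ⟨q, hq⟩ := LinearMap.exists_extend (g ∘ₗ p)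
  have hqf : g = q ∘ₗ f := by
    refine LinearMap.ext fun v => ?_
    have h1 : q (f v) = g (p (f.rangeRestrict v)) := LinearMap.congr_fun hq (f.rangeRestrict v)
    have h2 : f (p (f.rangeRestrict v)) = f v :=
      congrArg Subtype.val (LinearMap.congr_fun hp (f.rangeRestrict v))
    have h3 : g (v - p (f.rangeRestrict v)) = 0 := by
      refine h _ ?_
      change f _ = 0
      rw [map_sub, h2, sub_self]
    rw [map_sub, sub_eq_zero] at h3
    exact h3.trans h1.symm
  refine ⟨(LinearMap.toMatrix' q)ᴴ, conjTranspose_injective ?_⟩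
  rw [conjTranspose_mul, conjTranspose_conjTranspose]
  have := congrArg LinearMap.toMatrix' hqf
  simpa only [LinearMap.toMatrix'_comp, f, g, LinearMap.toMatrix'_toLin'] using this

/-- Two functions on a finite type taking each value equally often differ by a permutation. -/
theorem exists_perm_comp_eq_of_map_univ_eq {α β : Type*} [Fintype α] {f g : α → β}
    (h : Finset.univ.val.map f = Finset.univ.val.map g) :
    ∃ π : Equiv.Perm α, g ∘ π = f := by
  classical
  have hc (b : β) : Fintype.card {a // f a = b} = Fintype.card {a // g a = b} := by
    have := congrArg (Multiset.count b) h
    simp only [Multiset.count_map] at this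
    simp only [Fintype.card_subtype, Finset.card_def, Finset.filter_val, eq_comm (b := b)]
    exact this
  exact ⟨Equiv.ofFiberEquiv fun b => Fintype.equivOfCardEq (hc b), funext fun a =>
    Equiv.ofFiberEquiv_map _ a⟩

/-- A linear map between square complex matrix spaces that commutes with the conjugate transpose
and lowers the size annihilates some nonzero Hermitian matrix. -/
theorem exists_isHermitian_ne_zero_of_card_lt {r s : Type*} [Fintype r] [Fintype s]
    (hrs : Fintype.card s < Fintype.card r) (Φ : Matrix r r ℂ →ₗ[ℂ] Matrix s s ℂ)
    (hΦ : ∀ H, Φ Hᴴ = (Φ H)ᴴ) : ∃ H : Matrix r r ℂ, H.IsHermitian ∧ H ≠ 0 ∧ Φ H = 0 := by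
  have hker : LinearMap.ker Φ ≠ ⊥ := by
    refine Φ.ker_ne_bot_of_finrank_lt ?_
    rw [Module.finrank_matrix, Module.finrank_matrix, Module.finrank_self, mul_one, mul_one]
    exact Nat.mul_self_lt_mul_self hrs
  obtain ⟨K, hK, hK0⟩ := (Submodule.ne_bot_iff _).mp hker
  have hK' : Φ K = 0 := hK
  by_cases hsum : K + Kᴴ = 0
  · refine ⟨Complex.I • K, ?_, ?_, ?_⟩
    · rw [IsHermitian, conjTranspose_smul, eq_neg_of_add_eq_zero_right hsum]
      simp
    · exact smul_ne_zero Complex.I_ne_zero hK0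
    · rw [map_smul, hK', smul_zero]
  · refine ⟨K + Kᴴ, ?_, hsum, ?_⟩
    · rw [IsHermitian, conjTranspose_add, conjTranspose_conjTranspose, add_comm]
    · rw [map_add, hΦ, hK', conjTranspose_zero, add_zero]

/-- If `ρ = ∑ c, S c * (S c)ᴴ` has rank less than the common number of columns of the `S c`, then
`ρ` has a decomposition of the same form whose factors are `S c * E` with fewer columns. -/
theorem exists_sum_mul_conjTranspose_of_rank_lt {ι m : Type*} [Fintype ι] [Fintype m] {r : ℕ}
    (S : ι → Matrix m (Fin r) ℂ) (hr : (∑ c, S c * (S c)ᴴ).rank < r) :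
    ∃ q < r, ∃ E : Matrix (Fin r) (Fin q) ℂ,
      ∑ c, (S c * E) * (S c * E)ᴴ = ∑ c, S c * (S c)ᴴ := by
  have hρ : (∑ c, S c * (S c)ᴴ).PosSemidef :=
    posSemidef_sum _ fun c _ => posSemidef_self_mul_conjTranspose (S c)
  obtain ⟨s, hs, C, hC⟩ : ∃ s < r, ∃ C : Matrix m (Fin s) ℂ, ∑ c, S c * (S c)ᴴ = C * Cᴴ :=
    ⟨_, hr, hρ.exists_eq_mul_conjTranspose_rank⟩
  have hfac (c : ι) : ∃ X : Matrix (Fin s) (Fin r) ℂ, S c = C * X := by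
    refine exists_eq_mul_of_conjTranspose_ker_le C (S c) fun v hv => ?_
    have h1 : (∑ c, S c * (S c)ᴴ) *ᵥ v = 0 := by
      rw [hC, ← mulVec_mulVec, hv, mulVec_zero]
    have h2 : ∑ c, star ((S c)ᴴ *ᵥ v) ⬝ᵥ ((S c)ᴴ *ᵥ v) = 0 := by
      have h3 := congrArg (star v ⬝ᵥ ·) h1
      simp only [sum_mulVec, dotProduct_sum, dotProduct_zero] at h3
      rw [← h3]
      refine Finset.sum_congr rfl fun c _ => ?_
      rw [star_mulVec, conjTranspose_conjTranspose, ← dotProduct_mulVec, mulVec_mulVec]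
    exact dotProduct_star_self_eq_zero.mp
      ((Finset.sum_eq_zero_iff_of_nonneg fun c _ => dotProduct_star_self_nonneg _).mp h2 c
        (Finset.mem_univ c))
  choose X hX using hfac
  let Φ : Matrix (Fin r) (Fin r) ℂ →ₗ[ℂ] Matrix (Fin s) (Fin s) ℂ :=
    { toFun H := ∑ c, X c * H * (X c)ᴴ
      map_add' H K := by simp [Matrix.mul_add, Matrix.add_mul, Finset.sum_add_distrib]
      map_smul' a H := by simp [Finset.smul_sum] }
  obtain ⟨H, hH, hH0, hΦH⟩ := exists_isHermitian_ne_zero_of_card_lt (by simpa using hs) Φ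
    fun H => by simp [Φ, conjTranspose_sum, Matrix.mul_assoc]
  obtain ⟨t, ht, htr⟩ := hH.exists_one_add_smul_posSemidef hH0
  obtain ⟨E, hE⟩ := ht.exists_eq_mul_conjTranspose_rank
  refine ⟨_, by simpa using htr, E, ?_⟩
  have hS (c : ι) : (S c * E) * (S c * E)ᴴ = S c * (S c)ᴴ + t • (C * (X c * H * (X c)ᴴ) * Cᴴ) := by
    calc (S c * E) * (S c * E)ᴴ = S c * (E * Eᴴ) * (S c)ᴴ := by
          simp only [conjTranspose_mul, Matrix.mul_assoc]
      _ = S c * (S c)ᴴ + t • (S c * H * (S c)ᴴ) := by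
          rw [← hE]
          simp [Matrix.mul_add, Matrix.add_mul]
      _ = _ := by
          have h : S c * H * (S c)ᴴ = C * (X c * H * (X c)ᴴ) * Cᴴ := by
            simp only [hX c, conjTranspose_mul, Matrix.mul_assoc]
          rw [h]
  have h0 : ∑ c, X c * H * (X c)ᴴ = 0 := hΦH
  simp only [hS, Finset.sum_add_distrib]
  rw [← Finset.smul_sum, ← Matrix.sum_mul, ← Matrix.mul_sum, h0]
  simp

/-- The range of a matrix is symmetric iff its columns are. -/
theorem forall_mem_range_isSymVec_iff {N d : ℕ}
    (M : Matrix (Fin N → Fin d) (Fin N → Fin d) ℂ) :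
    (∀ v ∈ LinearMap.range M.mulVecLin, IsSymVec N d v) ↔
      ∀ π : Equiv.Perm (Fin N), M.submatrix (· ∘ π) id = M := by
  constructor
  · intro h π
    ext f g
    simpa using h _ ⟨Pi.single g 1, rfl⟩ π f
  · rintro h _ ⟨v, rfl⟩ π f
    exact congrArg (· ⬝ᵥ v) (congrFun (h π) f)

/-- The part of a matrix whose row indices end in `c`. -/
def rowSlice {N k d : ℕ} {r : Type*} (B : Matrix (Fin N → Fin d) r ℂ) (c : Fin (N - k) → Fin d) :
    Matrix (Fin k → Fin d) r ℂ :=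
  B.submatrix (appendIdx · c) id

theorem ptrLast_mul_conjTranspose {N k d : ℕ} {r : Type*} [Fintype r]
    (B : Matrix (Fin N → Fin d) r ℂ) :
    ptrLast N k d (B * Bᴴ) = ∑ c, rowSlice B c * (rowSlice B c)ᴴ := by
  ext x y
  rw [Matrix.sum_apply]
  rfl

theorem appendIdx_bijective {N k d : ℕ} (hkN : k ≤ N) :
    Function.Bijective fun p : (Fin k → Fin d) × (Fin (N - k) → Fin d) => appendIdx p.1 p.2 := by
  refine Function.bijective_iff_has_inverse.mpr
    ⟨fun f => (fun i => f (Fin.castLE hkN i), fun i => f ⟨i + k, by omega⟩), ?_, ?_⟩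
  · rintro ⟨x, c⟩
    ext i <;> simp [appendIdx]
  · intro f
    ext i
    by_cases h : (i : ℕ) < k
    · simp [appendIdx, h]
    · simp [appendIdx, h, Nat.sub_add_cancel (not_lt.mp h)]

theorem trace_ptrLast {N k d : ℕ} (hkN : k ≤ N) (M : Matrix (Fin N → Fin d) (Fin N → Fin d) ℂ) :
    (ptrLast N k d M).trace = M.trace := by
  simp only [trace, diag_apply, ptrLast]
  rw [← (appendIdx_bijective hkN).sum_comp fun f => M f f, Fintype.sum_prod_type]

theorem exists_perm_appendIdx_comp {N k d : ℕ} (hkN : k ≤ N) (π : Equiv.Perm (Fin k)) :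
    ∃ π' : Equiv.Perm (Fin N), ∀ (x : Fin k → Fin d) (c : Fin (N - k) → Fin d),
      appendIdx (x ∘ π) c = appendIdx x c ∘ π' := by
  refine ⟨π.viaFintypeEmbedding (Fin.castLEEmb hkN), fun x c => funext fun i => ?_⟩
  by_cases h : (i : ℕ) < k
  · obtain ⟨j, rfl⟩ : ∃ j : Fin k, i = Fin.castLEEmb hkN j := ⟨⟨i, h⟩, rfl⟩
    rw [Function.comp_apply, Equiv.Perm.viaFintypeEmbedding_apply_image]
    simp [appendIdx]
  · rw [Function.comp_apply, Equiv.Perm.viaFintypeEmbedding_apply_notMem_range]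
    · simp [appendIdx, h]
    · rintro ⟨j, rfl⟩
      exact h j.isLt

theorem ptrLast_submatrix_perm {N k d : ℕ} (hkN : k ≤ N)
    {M : Matrix (Fin N → Fin d) (Fin N → Fin d) ℂ}
    (hM : ∀ π : Equiv.Perm (Fin N), M.submatrix (· ∘ π) id = M) (π : Equiv.Perm (Fin k)) :
    (ptrLast N k d M).submatrix (· ∘ π) id = ptrLast N k d M := by
  obtain ⟨π', hπ'⟩ := exists_perm_appendIdx_comp (d := d) hkN π
  ext x y
  refine Finset.sum_congr rfl fun c _ => ?_
  simp only [hπ']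
  exact congrFun₂ (hM π') _ _

/-- The left factor of `B * Bᴴ` inherits its invariance under a map of the row indices. -/
theorem submatrix_eq_of_mul_conjTranspose {m r : Type*} [Fintype r] {B : Matrix m r ℂ}
    (e : m → m) (h : (B * Bᴴ).submatrix e id = B * Bᴴ) : B.submatrix e id = B := by
  have h1 : (B.submatrix e id - B) * Bᴴ = 0 := by
    rw [Matrix.sub_mul, sub_eq_zero]
    exact h
  have h2 : (B.submatrix e id - B) * (B.submatrix e id)ᴴ = 0 :=
    congrArg (Matrix.submatrix · id e) h1
  rw [← sub_eq_zero]
  ext i j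
  have h3 : (B.submatrix e id - B) * (B.submatrix e id - B)ᴴ = 0 := by
    rw [conjTranspose_sub, Matrix.mul_sub, h1, h2, sub_zero]
  have h4 := congrFun₂ h3 i i
  exact congrFun (dotProduct_self_star_eq_zero.mp h4) j

/-- The rank of a matrix with symmetric columns is at most the dimension of the boson space. -/
theorem rank_le_choose_of_submatrix_perm {k d : ℕ} {r : Type*} [Fintype r]
    {M : Matrix (Fin k → Fin d) r ℂ}
    (hM : ∀ π : Equiv.Perm (Fin k), M.submatrix (· ∘ π) id = M) :
    M.rank ≤ Nat.choose (d + k - 1) k := by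
  classical
  let t (f : Fin k → Fin d) : Sym (Fin d) k := ⟨Finset.univ.val.map f, by simp⟩
  have hft : M.row.FactorsThrough t := by
    intro f g hfg
    obtain ⟨π, rfl⟩ := exists_perm_comp_eq_of_map_univ_eq (f := f) (g := g) (congrArg Subtype.val hfg)
    exact congrFun (hM π) g
  have hrange : Set.range M.row ⊆ Set.range (Function.extend t M.row 0) := by
    rintro _ ⟨f, rfl⟩
    exact ⟨t f, hft.extend_apply _ _⟩
  calc M.rank = Module.finrank ℂ (Submodule.span ℂ (Set.range M.row)) :=
        M.rank_eq_finrank_span_row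
    _ ≤ (Set.range (Function.extend t M.row 0)).finrank ℂ :=
        Submodule.finrank_mono (Submodule.span_mono hrange)
    _ ≤ Fintype.card (Sym (Fin d) k) := finrank_range_le_card _
    _ = Nat.choose (d + k - 1) k := by rw [Sym.card_sym_eq_choose, Fintype.card_fin]

/-- **Rank reduction for the bosonic `N`-representability problem.**
If an `N`-boson density operator `σ` on `(ℂ^d)^{⊗N}` (every vector in its range is
symmetric) has `k`-particle reduced state `ρ = tr_{k+1,…,N}(σ)`, then there is an
`N`-boson density operator `σ'` with `tr_{k+1,…,N}(σ') = ρ` and `rank σ' ≤ rank ρ`;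
moreover `rank ρ ≤ C(d + k - 1, k)`. -/
theorem bosonic_rank_reduction
    (N d k : ℕ) (hN : 0 < N) (hd : 0 < d) (hk : 0 < k) (hkN : k ≤ N)
    (σ : Matrix (Fin N → Fin d) (Fin N → Fin d) ℂ)
    (hσ : σ.PosSemidef ∧ σ.trace = 1)
    (hsym : ∀ v ∈ LinearMap.range σ.mulVecLin, IsSymVec N d v) :
    ∃ σ' : Matrix (Fin N → Fin d) (Fin N → Fin d) ℂ,
      (σ'.PosSemidef ∧ σ'.trace = 1) ∧
      (∀ v ∈ LinearMap.range σ'.mulVecLin, IsSymVec N d v) ∧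
      ptrLast N k d σ' = ptrLast N k d σ ∧
      σ'.rank ≤ (ptrLast N k d σ).rank ∧
      (ptrLast N k d σ).rank ≤ Nat.choose (d + k - 1) k := by
  have hσsym := (forall_mem_range_isSymVec_iff σ).mp hsym
  have hex : ∃ r : ℕ, ∃ B : Matrix (Fin N → Fin d) (Fin r) ℂ,
      (∀ π : Equiv.Perm (Fin N), B.submatrix (· ∘ π) id = B) ∧
        ptrLast N k d (B * Bᴴ) = ptrLast N k d σ := by
    obtain ⟨B, hB⟩ := hσ.1.exists_eq_mul_conjTranspose_rank
    exact ⟨_, B, fun π => submatrix_eq_of_mul_conjTranspose _ (hB ▸ hσsym π), by rw [← hB]⟩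
  obtain ⟨r, ⟨B, hBsym, hB⟩, hr⟩ :=
    exists_minimal_of_wellFoundedLT _ hex
  have hmin : r ≤ (ptrLast N k d σ).rank := by
    by_contra! hlt
    rw [← hB, ptrLast_mul_conjTranspose] at hlt
    obtain ⟨q, hq, E, hE⟩ := exists_sum_mul_conjTranspose_of_rank_lt _ hlt
    refine hq.not_ge (hr (y := q) ⟨B * E, fun π => ?_, ?_⟩ hq.le)
    · exact congrArg (· * E) (hBsym π)
    · rw [← hB, ptrLast_mul_conjTranspose, ptrLast_mul_conjTranspose]
      exact hE
  refine ⟨B * Bᴴ, ⟨posSemidef_self_mul_conjTranspose B, ?_⟩, ?_, hB, ?_, ?_⟩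
  · rw [← trace_ptrLast hkN, hB, trace_ptrLast hkN, hσ.2]
  · exact (forall_mem_range_isSymVec_iff _).mpr fun π => congrArg (· * Bᴴ) (hBsym π)
  · exact (rank_mul_le_left _ _).trans (le_trans (by simpa using B.rank_le_card_width) hmin)
  · exact rank_le_choose_of_submatrix_perm (ptrLast_submatrix_perm hkN hσsym)
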